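/- arXiv:2112.15504 — 2 statements merged into one kernel-verified Lean document; each statement's English description precedes it below -/
import Mathlib

section
/- Let 0 < γ0 ≤ γ1 < 1. There exist constants c > 0 and C > 0 depending only on γ0 and γ1 such that for every γ ∈ [γ0, γ1], every T > 0, every t ∈ (0, T] and every ξ ∈ ℝⁿ, c ≤ E_γ(−|ξ|² t^γ)/E_γ(−|ξ|² T^γ) ≤ C (T/t)^γ. -/
/-- The Mittag-Leffler function `E_γ(x) = ∑ x^k / Γ(γ k + 1)`. -/
noncomputable def mlE (γ x : ℝ) : ℝ := ∑' k : ℕ, x ^ k / Real.Gamma (γ * k + 1)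

open Filter Topology MeasureTheory Set

/-- Two-parameter Mittag-Leffler function at `-x`. -/
noncomputable def mlG (γ b x : ℝ) : ℝ := ∑' k : ℕ, (-x) ^ k / Real.Gamma (γ * k + b)

theorem gamma_ratio {γ y : ℝ} (hγ : 0 < γ) (hy : 1 < y) :
    (y - 1) ^ γ ≤ Real.Gamma (y + γ) / Real.Gamma y := by
  have h := Real.convexOn_log_Gamma.slope_mono_adjacent (x := y - 1) (y := y) (z := y + γ)
    (by simp; linarith) (by simp; linarith) (by linarith) (by linarith)
  have hg : Real.Gamma y = (y - 1) * Real.Gamma (y - 1) := by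
    have := Real.Gamma_add_one (s := y - 1) (by linarith)
    rwa [sub_add_cancel] at this
  have hp : 0 < Real.Gamma (y - 1) := Real.Gamma_pos_of_pos (by linarith)
  have hp1 : 0 < Real.Gamma y := Real.Gamma_pos_of_pos (by linarith)
  have hp2 : 0 < Real.Gamma (y + γ) := Real.Gamma_pos_of_pos (by linarith)
  have hl : Real.log (Real.Gamma y) = Real.log (y - 1) + Real.log (Real.Gamma (y - 1)) := by
    rw [hg, Real.log_mul (by linarith) hp.ne']
  simp only [Function.comp] at h
  rw [sub_sub_cancel, div_one, add_sub_cancel_left, le_div_iff₀ hγ, hl] at h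
  rw [← Real.log_le_log_iff (Real.rpow_pos_of_pos (by linarith) _) (div_pos hp2 hp1),
    Real.log_rpow (by linarith), Real.log_div hp2.ne' hp1.ne']
  linarith

theorem gamma_pos' {γ b : ℝ} (hγ : 0 < γ) (hb : 0 < b) (k : ℕ) :
    0 < Real.Gamma (γ * k + b) := Real.Gamma_pos_of_pos (by positivity)

theorem coeff_ratio {γ b : ℝ} (hγ : 0 < γ) (hb : 0 < b) :
    Tendsto (fun k : ℕ => Real.Gamma (γ * k + b) / Real.Gamma (γ * (k + 1 : ℕ) + b))
      atTop (𝓝 0) := by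
  have hlin : Tendsto (fun k : ℕ => γ * (k : ℝ) + b - 1) atTop atTop := by
    have : Tendsto (fun k : ℕ => γ * (k : ℝ) + (b - 1)) atTop atTop :=
      tendsto_atTop_add_const_right _ _ (tendsto_natCast_atTop_atTop.const_mul_atTop hγ)
    simpa [add_sub_assoc] using this
  have h1 : Tendsto (fun k : ℕ => ((γ * (k : ℝ) + b - 1) ^ γ)⁻¹) atTop (𝓝 0) :=
    ((tendsto_rpow_atTop hγ).comp hlin).inv_tendsto_atTop
  refine tendsto_of_tendsto_of_tendsto_of_le_of_le' tendsto_const_nhds h1 ?_ ?_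
  · exact Eventually.of_forall fun k => (div_pos (gamma_pos' hγ hb _) (gamma_pos' hγ hb _)).le
  · filter_upwards [hlin.eventually_gt_atTop 0] with k hk
    have := gamma_ratio hγ (y := γ * k + b) (by linarith)
    rw [← inv_div]
    have e : γ * ((k + 1 : ℕ) : ℝ) + b = γ * k + b + γ := by push_cast; ring
    rw [e]
    exact inv_anti₀ (Real.rpow_pos_of_pos hk _) this

theorem mlG_analytic {γ b : ℝ} (hγ : 0 < γ) (hb : 0 < b) (x : ℝ) : AnalyticAt ℝ (mlG γ b) x := by
  set c : ℕ → ℝ := fun k => (-1) ^ k / Real.Gamma (γ * k + b) with hc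
  have hr : (FormalMultilinearSeries.ofScalars ℝ c).radius = ⊤ := by
    apply FormalMultilinearSeries.ofScalars_radius_eq_top_of_tendsto
    · exact Eventually.of_forall fun k =>
        div_ne_zero (pow_ne_zero _ (by norm_num)) (gamma_pos' hγ hb _).ne'
    · refine (coeff_ratio hγ hb).congr fun k => ?_
      simp only [hc, norm_div, norm_pow, norm_neg, norm_one, one_pow, Real.norm_eq_abs,
        abs_of_pos (gamma_pos' hγ hb _), Nat.succ_eq_add_one]
      rw [div_div_div_cancel_left' _ _ one_ne_zero]
  have h2 := (FormalMultilinearSeries.ofScalars ℝ c).hasFPowerSeriesOnBall (by rw [hr]; simp)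
  have h3 : (FormalMultilinearSeries.ofScalars ℝ c).sum = mlG γ b := by
    ext y
    unfold mlG FormalMultilinearSeries.sum
    refine tsum_congr fun k => ?_
    rw [FormalMultilinearSeries.ofScalars_apply_eq, hc, neg_pow, smul_eq_mul]
    ring
  rw [h3, hr] at h2
  exact h2.analyticAt_of_mem (by simp)

theorem mlG_summable {γ b : ℝ} (hγ : 0 < γ) (hb : 0 < b) (x : ℝ) :
    Summable fun k : ℕ => x ^ k / Real.Gamma (γ * k + b) := by
  by_cases hx : x = 0
  · refine summable_of_ne_finset_zero (s := {0}) fun k hk => ?_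
    simp at hk
    simp [hx, hk]
  · apply summable_of_ratio_test_tendsto_lt_one (l := 0) (by norm_num)
    · exact Eventually.of_forall fun k => div_ne_zero (pow_ne_zero _ hx) (gamma_pos' hγ hb _).ne'
    · have := (coeff_ratio hγ hb).const_mul |x|
      rw [mul_zero] at this
      refine this.congr fun k => ?_
      have := (gamma_pos' hγ hb k).ne'
      have := (gamma_pos' hγ hb (k+1)).ne'
      have : |x| ≠ 0 := by simpa
      simp only [norm_div, norm_pow, Real.norm_eq_abs, abs_of_pos (gamma_pos' hγ hb _)]
      field_simp
      ring

theorem beta_int {a b t : ℝ} (ha : 0 < a) (hb : 0 < b) (ht : 0 < t) :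
    ∫ s in (0:ℝ)..t, s ^ (b - 1) * (t - s) ^ (a - 1) =
      t ^ (a + b - 1) * (Real.Gamma a * Real.Gamma b / Real.Gamma (a + b)) := by
  have h := Complex.betaIntegral_scaled (b : ℂ) (a : ℂ) ht
  rw [Complex.betaIntegral_eq_Gamma_mul_div _ _ (by simpa) (by simpa)] at h
  rw [← Complex.ofReal_inj, ← intervalIntegral.integral_ofReal]
  have e : ∫ s in (0:ℝ)..t, ((s ^ (b - 1) * (t - s) ^ (a - 1) : ℝ) : ℂ) =
      ∫ s in (0:ℝ)..t, (s : ℂ) ^ ((b:ℂ) - 1) * ((t : ℂ) - s) ^ ((a:ℂ) - 1) := by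
    refine intervalIntegral.integral_congr fun s hs => ?_
    rw [uIcc_of_le ht.le] at hs
    rw [Complex.ofReal_mul, Complex.ofReal_cpow hs.1, Complex.ofReal_cpow (by linarith [hs.2])]
    push_cast
    rfl
  rw [e, h]
  push_cast [Complex.ofReal_cpow ht.le]
  rw [← Complex.ofReal_add, ← Complex.ofReal_add, Complex.Gamma_ofReal, Complex.Gamma_ofReal, Complex.Gamma_ofReal, add_comm b a]
  push_cast
  ring

theorem beta_integrable {a b t : ℝ} (ha : 0 < a) (hb : 0 < b) (ht : 0 < t) :
    IntervalIntegrable (fun s => s ^ (b - 1) * (t - s) ^ (a - 1)) volume 0 t := by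
  by_contra h
  have h1 := intervalIntegral.integral_undef h
  rw [beta_int ha hb ht] at h1
  have := Real.Gamma_pos_of_pos ha
  have := Real.Gamma_pos_of_pos hb
  have := Real.Gamma_pos_of_pos (add_pos ha hb)
  have : 0 < t ^ (a + b - 1) * (Real.Gamma a * Real.Gamma b / Real.Gamma (a + b)) := by positivity
  linarith

theorem conv_integrable {γ a b t : ℝ} (hγ : 0 < γ) (ha : 0 < a) (hb : 0 < b) (ht : 0 < t) :
    IntervalIntegrable (fun s => (t - s) ^ (a - 1) * (s ^ (b - 1) * mlG γ b (s ^ γ))) volume 0 t := by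
  have hc : Continuous (fun s : ℝ => mlG γ b (s ^ γ)) := by
    have : Continuous (mlG γ b) :=
      continuous_iff_continuousAt.2 fun x => (mlG_analytic hγ hb x).continuousAt
    exact this.comp (Real.continuous_rpow_const hγ.le)
  have := (beta_integrable ha hb ht).mul_continuousOn hc.continuousOn
  refine this.congr fun s _ => ?_
  ring

theorem conv {γ a b t : ℝ} (hγ : 0 < γ) (ha : 0 < a) (hb : 0 < b) (ht : 0 < t) :
    ∫ s in (0:ℝ)..t, (t - s) ^ (a - 1) * (s ^ (b - 1) * mlG γ b (s ^ γ)) =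
      Real.Gamma a * (t ^ (a + b - 1) * mlG γ (a + b) (t ^ γ)) := by
  set f : ℕ → ℝ → ℝ := fun k s =>
    ((-1) ^ k / Real.Gamma (γ * k + b)) * (s ^ (γ * k + b - 1) * (t - s) ^ (a - 1)) with hf
  have hpos : ∀ k : ℕ, 0 < γ * k + b := fun k => by positivity
  have hint : ∀ k, Integrable (f k) (volume.restrict (Ioc 0 t)) := fun k => by
    have := (beta_integrable ha (hpos k) ht).const_mul ((-1) ^ k / Real.Gamma (γ * k + b))
    rw [intervalIntegrable_iff_integrableOn_Ioc_of_le ht.le] at this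
    exact this
  have hval : ∀ k : ℕ, ∫ s in Ioc 0 t, (s ^ (γ * k + b - 1) * (t - s) ^ (a - 1)) =
      Real.Gamma (γ * k + b) * (Real.Gamma a * (t ^ (a + b - 1) * ((t ^ γ) ^ k / Real.Gamma (γ * k + (a + b))))) := by
    intro k
    rw [← intervalIntegral.integral_of_le ht.le, beta_int ha (hpos k) ht]
    have e1 : a + (γ * k + b) = γ * k + (a + b) := by ring
    have e2 : a + (γ * k + b) - 1 = (a + b - 1) + γ * k := by ring
    rw [e2, Real.rpow_add ht, Real.rpow_mul ht.le, Real.rpow_natCast, e1]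
    ring
  have hnorm : ∀ k : ℕ, ∫ s in Ioc 0 t, ‖f k s‖ =
      Real.Gamma a * (t ^ (a + b - 1) * ((t ^ γ) ^ k / Real.Gamma (γ * k + (a + b)))) := by
    intro k
    have hg := gamma_pos' hγ hb k
    have : ∫ s in Ioc 0 t, ‖f k s‖ = ∫ s in Ioc 0 t,
        (Real.Gamma (γ * k + b))⁻¹ * (s ^ (γ * k + b - 1) * (t - s) ^ (a - 1)) := by
      refine setIntegral_congr_fun measurableSet_Ioc fun s hs => ?_
      have h1 : 0 ≤ s ^ (γ * k + b - 1) * (t - s) ^ (a - 1) :=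
        mul_nonneg (Real.rpow_nonneg hs.1.le _) (Real.rpow_nonneg (by linarith [hs.2]) _)
      simp only [hf]
      rw [norm_mul, Real.norm_of_nonneg h1, norm_div, norm_pow, norm_neg, norm_one, one_pow,
        Real.norm_of_nonneg hg.le, one_div]
    rw [this, integral_const_mul, hval, inv_mul_cancel_left₀ hg.ne']
  have hsum : Summable fun k => ∫ s in Ioc 0 t, ‖f k s‖ := by
    simp_rw [hnorm]
    exact ((mlG_summable hγ (add_pos ha hb) _).mul_left _).mul_left _
  have key := (hasSum_integral_of_summable_integral_norm hint hsum).tsum_eq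
  rw [intervalIntegral.integral_of_le ht.le]
  have hL : ∫ s in Ioc 0 t, (t - s) ^ (a - 1) * (s ^ (b - 1) * mlG γ b (s ^ γ)) =
      ∫ s in Ioc 0 t, ∑' k, f k s := by
    refine setIntegral_congr_fun measurableSet_Ioc fun s hs => ?_
    simp only [hf, mlG]
    rw [← tsum_mul_left, ← tsum_mul_left]
    refine tsum_congr fun k => ?_
    have e2 : γ * k + b - 1 = (b - 1) + γ * k := by ring
    rw [e2, Real.rpow_add hs.1, Real.rpow_mul hs.1.le, Real.rpow_natCast, neg_pow (s ^ γ)]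
    ring
  rw [hL, ← key, mlG, ← tsum_mul_left, ← tsum_mul_left]
  refine tsum_congr fun k => ?_
  simp only [hf]
  rw [integral_const_mul, hval, neg_pow (t ^ γ)]
  have hg := (gamma_pos' hγ hb k).ne'
  field_simp

theorem mlG_zero {γ b : ℝ} : mlG γ b 0 = 1 / Real.Gamma b := by
  unfold mlG
  rw [tsum_eq_single 0]
  · simp
  · intro k hk
    simp [hk]

/-- index shift -/
theorem mlG_shift {γ x : ℝ} (hγ : 0 < γ) : x * mlG γ (γ + 1) x = 1 - mlG γ 1 x := by
  have h := (mlG_summable hγ one_pos (-x)).tsum_eq_zero_add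
  unfold mlG
  rw [h, ← tsum_mul_left]
  simp only [pow_zero, Nat.cast_zero, mul_zero, zero_add, Real.Gamma_one, div_one]
  rw [sub_add_cancel_left, ← tsum_neg]
  refine tsum_congr fun k => ?_
  push_cast
  rw [show γ * ((k:ℝ) + 1) + 1 = γ * k + (γ + 1) by ring, pow_succ]
  ring

theorem first_sign {g : ℝ → ℝ} (hg : ∀ x, AnalyticAt ℝ g x) (h0 : 0 < g 0)
    {x0 : ℝ} (hx0 : 0 ≤ x0) (hneg : g x0 < 0) :
    ∃ x1 x2 : ℝ, 0 < x1 ∧ x1 < x2 ∧ (∀ x, 0 ≤ x → x ≤ x1 → 0 ≤ g x) ∧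
      ∀ x, x1 < x → x < x2 → g x < 0 := by
  have hc : Continuous g := continuous_iff_continuousAt.2 fun x => (hg x).continuousAt
  set S : Set ℝ := {x | 0 ≤ x ∧ g x < 0} with hS
  have hne : S.Nonempty := ⟨x0, hx0, hneg⟩
  have hbd : BddBelow S := ⟨0, fun x hx => hx.1⟩
  set x1 := sInf S with hx1
  have hx1n : 0 ≤ x1 := le_csInf hne fun x hx => hx.1
  have hlt : ∀ x, 0 ≤ x → x < x1 → 0 ≤ g x := by
    intro x hx hxx
    by_contra h
    exact notMem_of_lt_csInf hxx hbd ⟨hx, not_le.1 h⟩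
  have hgx1 : 0 ≤ g x1 := by
    by_contra h
    push Not at h
    have hpos : 0 < x1 := by
      rcases hx1n.eq_or_lt with h' | h'
      · rw [← h'] at h; linarith
      · exact h'
    have ev : ∀ᶠ x in 𝓝[<] x1, g x < 0 :=
      nhdsWithin_le_nhds (hc.continuousAt.eventually_lt_const h)
    have ev2 : ∀ᶠ x in 𝓝[<] x1, 0 < x := nhdsWithin_le_nhds (eventually_gt_nhds hpos)
    obtain ⟨x, h1, h2, h3⟩ := (ev.and (ev2.and self_mem_nhdsWithin)).exists
    exact absurd (hlt x h2.le h3) (not_le.2 h1)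
  have hright : ∀ δ, x1 < δ → ∃ s, x1 < s ∧ s < δ ∧ g s < 0 := by
    intro δ hδ
    obtain ⟨s, hs, hsδ⟩ := exists_lt_of_csInf_lt hne hδ
    refine ⟨s, lt_of_le_of_ne (csInf_le hbd hs) ?_, hsδ, hs.2⟩
    intro h
    rw [← h] at hs
    linarith [hs.2]
  have hpos : 0 < x1 := by
    rcases hx1n.eq_or_lt with h' | h'
    · exfalso
      have ev : ∀ᶠ x in 𝓝[>] x1, 0 < g x := by
        refine nhdsWithin_le_nhds (hc.continuousAt.eventually_const_lt ?_)
        rw [← h']; exact h0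
      obtain ⟨δ, hδ, hδ2⟩ := (mem_nhdsGT_iff_exists_Ioo_subset).1 ev
      obtain ⟨s, h1, h2, h3⟩ := hright δ hδ
      have : 0 < g s := hδ2 ⟨h1, h2⟩
      linarith
    · exact h'
  have hnz : ∀ᶠ x in 𝓝[>] x1, g x ≠ 0 := by
    rcases (hg x1).eventually_eq_zero_or_eventually_ne_zero with h | h
    · exfalso
      obtain ⟨δ, hδ, hδ2⟩ := (mem_nhdsGT_iff_exists_Ioo_subset).1 (nhdsWithin_le_nhds h)
      obtain ⟨s, h1, h2, h3⟩ := hright δ hδ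
      have : g s = 0 := hδ2 ⟨h1, h2⟩
      linarith
    · exact nhdsWithin_mono _ (fun x hx => ne_of_gt hx) h
  obtain ⟨δ, hδ, hδ2⟩ := (mem_nhdsGT_iff_exists_Ioo_subset).1 hnz
  obtain ⟨x2, h1, h2, h3⟩ := hright δ hδ
  refine ⟨x1, x2, hpos, h1, fun x hx hxx => ?_, fun x hx hxx => ?_⟩
  · rcases hxx.eq_or_lt with h | h
    · rw [h]; exact hgx1
    · exact hlt x hx h
  · by_contra h
    push Not at h
    obtain ⟨y, hy, hy0⟩ := intermediate_value_Icc' hxx.le hc.continuousOn (⟨h3.le, h⟩ : (0:ℝ) ∈ Icc (g x2) (g x))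
    exact hδ2 (⟨lt_of_lt_of_le hx hy.1, lt_of_le_of_lt hy.2 h2⟩ : y ∈ Ioo x1 δ) hy0

section
variable {γ : ℝ}

theorem convA (hγ : 0 < γ) (h1 : γ < 1) {t : ℝ} (ht : 0 < t) :
    ∫ s in (0:ℝ)..t, (t - s) ^ (-γ) * (s ^ (γ - 1) * mlG γ γ (s ^ γ)) =
      Real.Gamma (1 - γ) * mlG γ 1 (t ^ γ) := by
  have := conv hγ (a := 1 - γ) (b := γ) (by linarith) hγ ht
  simpa using this

theorem convA_int (hγ : 0 < γ) (h1 : γ < 1) {t : ℝ} (ht : 0 < t) :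
    IntervalIntegrable (fun s => (t - s) ^ (-γ) * (s ^ (γ - 1) * mlG γ γ (s ^ γ))) volume 0 t := by
  have := conv_integrable hγ (a := 1 - γ) (b := γ) (by linarith) hγ ht
  simpa using this

theorem convB (hγ : 0 < γ) {t : ℝ} (ht : 0 < t) :
    ∫ s in (0:ℝ)..t, (s ^ (γ - 1) * mlG γ γ (s ^ γ)) = 1 - mlG γ 1 (t ^ γ) := by
  have := conv hγ (a := 1) (b := γ) (by linarith) hγ ht
  rw [← mlG_shift hγ]
  simpa [add_comm] using this

theorem convB_int (hγ : 0 < γ) {t : ℝ} (ht : 0 < t) :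
    IntervalIntegrable (fun s => (s ^ (γ - 1) * mlG γ γ (s ^ γ))) volume 0 t := by
  have := conv_integrable hγ (a := 1) (b := γ) (by linarith) hγ ht
  simpa using this

theorem convC (hγ : 0 < γ) {t : ℝ} (ht : 0 < t) :
    ∫ s in (0:ℝ)..t, (t - s) ^ (γ - 1) * mlG γ 1 (s ^ γ) =
      Real.Gamma γ * (1 - mlG γ 1 (t ^ γ)) := by
  have := conv hγ (a := γ) (b := 1) hγ one_pos ht
  rw [← mlG_shift hγ]
  simpa using this

theorem convC_int (hγ : 0 < γ) {t : ℝ} (ht : 0 < t) :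
    IntervalIntegrable (fun s => (t - s) ^ (γ - 1) * mlG γ 1 (s ^ γ)) volume 0 t := by
  have := conv_integrable hγ (a := γ) (b := 1) hγ one_pos ht
  simpa using this

theorem mlG_nonneg (hγ : 0 < γ) (h1 : γ < 1) {x : ℝ} (hx : 0 ≤ x) : 0 ≤ mlG γ γ x := by
  by_contra hneg
  push Not at hneg
  have hG0 : 0 < mlG γ γ 0 := by
    rw [mlG_zero]; exact one_div_pos.2 (Real.Gamma_pos_of_pos hγ)
  obtain ⟨x1, x2, hx1, hx12, hnn, hlt⟩ := first_sign (mlG_analytic hγ hγ) hG0 hx hneg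
  have hip : 0 < γ⁻¹ := inv_pos.2 hγ
  set t1 := x1 ^ γ⁻¹ with ht1
  set t2 := x2 ^ γ⁻¹ with ht2
  have ht1p : 0 < t1 := Real.rpow_pos_of_pos hx1 _
  have ht12 : t1 < t2 := Real.rpow_lt_rpow hx1.le hx12 hip
  have ht2p := ht1p.trans ht12
  have e1 : t1 ^ γ = x1 := Real.rpow_inv_rpow hx1.le hγ.ne'
  have e2 : t2 ^ γ = x2 := Real.rpow_inv_rpow (hx1.trans hx12).le hγ.ne'
  set r : ℝ → ℝ := fun s => s ^ (γ - 1) * mlG γ γ (s ^ γ) with hr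
  have hr1 : ∀ s, 0 < s → s ≤ t1 → 0 ≤ r s := fun s hs hs1 => by
    refine mul_nonneg (Real.rpow_nonneg hs.le _) (hnn _ (Real.rpow_nonneg hs.le _) ?_)
    rw [← e1]; exact Real.rpow_le_rpow hs.le hs1 hγ.le
  have hr2 : ∀ s, t1 < s → s < t2 → r s < 0 := fun s hs hs1 => by
    refine mul_neg_of_pos_of_neg (Real.rpow_pos_of_pos (ht1p.trans hs) _) (hlt _ ?_ ?_)
    · rw [← e1]; exact Real.rpow_lt_rpow ht1p.le hs hγ
    · rw [← e2]; exact Real.rpow_lt_rpow (ht1p.trans hs).le hs1 hγ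
  have A1 : ∫ s in (0:ℝ)..t1, (t1 - s) ^ (-γ) * r s = _ := convA hγ h1 ht1p
  have A2 : ∫ s in (0:ℝ)..t2, (t2 - s) ^ (-γ) * r s = _ := convA hγ h1 ht2p
  have B1 : ∫ s in (0:ℝ)..t1, r s = _ := convB hγ ht1p
  have B2 : ∫ s in (0:ℝ)..t2, r s = _ := convB hγ ht2p
  have I1 : IntervalIntegrable (fun s => (t1 - s) ^ (-γ) * r s) volume 0 t1 := convA_int hγ h1 ht1p
  have I2 : IntervalIntegrable (fun s => (t2 - s) ^ (-γ) * r s) volume 0 t2 := convA_int hγ h1 ht2p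
  have J2 : IntervalIntegrable r volume 0 t2 := convB_int hγ ht2p
  have m1 : uIcc (0:ℝ) t1 ⊆ uIcc 0 t2 := by
    rw [uIcc_of_le ht1p.le, uIcc_of_le ht2p.le]; exact Icc_subset_Icc le_rfl ht12.le
  have m2 : uIcc t1 t2 ⊆ uIcc 0 t2 := by
    rw [uIcc_of_le ht12.le, uIcc_of_le ht2p.le]; exact Icc_subset_Icc ht1p.le le_rfl
  rw [← intervalIntegral.integral_add_adjacent_intervals (I2.mono_set m1) (I2.mono_set m2)] at A2
  rw [← intervalIntegral.integral_add_adjacent_intervals (J2.mono_set m1) (J2.mono_set m2)] at B2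
  have N1 : 0 < ∫ s in t1..t2, -((t2 - s) ^ (-γ) * r s) :=
    intervalIntegral.intervalIntegral_pos_of_pos_on (I2.mono_set m2).neg
      (fun s hs => neg_pos.2 (mul_neg_of_pos_of_neg
        (Real.rpow_pos_of_pos (by linarith [hs.2]) _) (hr2 s hs.1 hs.2))) ht12
  have N2 : 0 < ∫ s in t1..t2, -(r s) :=
    intervalIntegral.intervalIntegral_pos_of_pos_on (J2.mono_set m2).neg
      (fun s hs => neg_pos.2 (hr2 s hs.1 hs.2)) ht12
  rw [intervalIntegral.integral_neg] at N1 N2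
  have M : ∫ s in (0:ℝ)..t1, (t2 - s) ^ (-γ) * r s ≤ ∫ s in (0:ℝ)..t1, (t1 - s) ^ (-γ) * r s := by
    refine intervalIntegral.integral_mono_on_of_le_Ioo ht1p.le (I2.mono_set m1) I1 fun s hs => ?_
    refine mul_le_mul_of_nonneg_right ?_ (hr1 s hs.1 hs.2.le)
    exact Real.rpow_le_rpow_of_nonpos (by linarith [hs.2]) (by linarith) (by linarith)
  have hΓ : 0 < Real.Gamma (1 - γ) := Real.Gamma_pos_of_pos (by linarith)
  have : mlG γ 1 (t1 ^ γ) < mlG γ 1 (t2 ^ γ) := by linarith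
  have := mul_lt_mul_of_pos_left this hΓ
  linarith

theorem phi_anti (hγ : 0 < γ) (h1 : γ < 1) {s t : ℝ} (hs : 0 < s) (hst : s ≤ t) :
    mlG γ 1 (t ^ γ) ≤ mlG γ 1 (s ^ γ) := by
  have B1 := convB hγ hs
  have B2 := convB hγ (hs.trans_le hst)
  have : ∫ s in (0:ℝ)..s, (s ^ (γ - 1) * mlG γ γ (s ^ γ)) ≤
      ∫ s in (0:ℝ)..t, (s ^ (γ - 1) * mlG γ γ (s ^ γ)) := by
    refine intervalIntegral.integral_mono_interval le_rfl hs.le hst ?_ (convB_int hγ (hs.trans_le hst))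
    rw [EventuallyLE, ae_restrict_iff' measurableSet_Ioc]
    filter_upwards with u hu
    exact mul_nonneg (Real.rpow_nonneg hu.1.le _) (mlG_nonneg hγ h1 (Real.rpow_nonneg hu.1.le _))
  linarith

theorem phi_lower (hγ : 0 < γ) (h1 : γ < 1) {t : ℝ} (ht : 0 < t) :
    1 ≤ (1 + Real.Gamma (1 - γ) * t ^ γ) * mlG γ 1 (t ^ γ) := by
  have M : ∫ s in (0:ℝ)..t, t ^ (-γ) * (s ^ (γ - 1) * mlG γ γ (s ^ γ)) ≤
      ∫ s in (0:ℝ)..t, (t - s) ^ (-γ) * (s ^ (γ - 1) * mlG γ γ (s ^ γ)) := by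
    refine intervalIntegral.integral_mono_on_of_le_Ioo ht.le ((convB_int hγ ht).const_mul _)
      (convA_int hγ h1 ht) fun s hs => ?_
    refine mul_le_mul_of_nonneg_right ?_ (mul_nonneg (Real.rpow_nonneg hs.1.le _)
      (mlG_nonneg hγ h1 (Real.rpow_nonneg hs.1.le _)))
    exact Real.rpow_le_rpow_of_nonpos (by linarith [hs.2]) (by linarith [hs.1]) (by linarith)
  rw [intervalIntegral.integral_const_mul, convB hγ ht, convA hγ h1 ht, Real.rpow_neg ht.le,
    inv_mul_le_iff₀ (Real.rpow_pos_of_pos ht _)] at M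
  linarith

theorem phi_upper (hγ : 0 < γ) (h1 : γ < 1) {t : ℝ} (ht : 0 < t) :
    (1 + t ^ γ / Real.Gamma (γ + 1)) * mlG γ 1 (t ^ γ) ≤ 1 := by
  have hk : ∫ s in (0:ℝ)..t, (t - s) ^ (γ - 1) = t ^ γ / γ := by
    rw [intervalIntegral.integral_comp_sub_left (fun s => s ^ (γ - 1)) t, sub_self, sub_zero,
      integral_rpow (Or.inl (by linarith)), sub_add_cancel, Real.zero_rpow hγ.ne', sub_zero]
  have hki : IntervalIntegrable (fun s => (t - s) ^ (γ - 1)) volume 0 t := by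
    have := beta_integrable hγ one_pos ht
    simpa using this
  have M : ∫ s in (0:ℝ)..t, (t - s) ^ (γ - 1) * mlG γ 1 (t ^ γ) ≤
      ∫ s in (0:ℝ)..t, (t - s) ^ (γ - 1) * mlG γ 1 (s ^ γ) := by
    refine intervalIntegral.integral_mono_on_of_le_Ioo ht.le (hki.mul_const _)
      (convC_int hγ ht) fun s hs => ?_
    exact mul_le_mul_of_nonneg_left (phi_anti hγ h1 hs.1 hs.2.le)
      (Real.rpow_nonneg (by linarith [hs.2]) _)
  have hΓ := Real.Gamma_pos_of_pos hγ
  rw [intervalIntegral.integral_mul_const, hk, convC hγ ht, ← div_le_iff₀' hΓ] at M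
  rw [Real.Gamma_add_one hγ.ne']
  have e : t ^ γ / (γ * Real.Gamma γ) * mlG γ 1 (t ^ γ) = t ^ γ / γ * mlG γ 1 (t ^ γ) / Real.Gamma γ := by
    field_simp
  linarith

end

theorem gamma_le_one {y : ℝ} (h1 : 1 ≤ y) (h2 : y ≤ 2) : Real.Gamma y ≤ 1 := by
  have := Real.convexOn_Gamma.2 (show (1:ℝ) ∈ Ioi 0 by simp) (show (2:ℝ) ∈ Ioi 0 by simp)
    (show 0 ≤ 2 - y by linarith) (show 0 ≤ y - 1 by linarith) (by ring)
  simp only [smul_eq_mul, Real.Gamma_one, Real.Gamma_two] at this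
  rw [show (2 - y) * 1 + (y - 1) * 2 = y by ring] at this
  linarith

theorem ml_bounds {γ C x : ℝ} (hγ : 0 < γ) (h1 : γ < 1) (hC : 1 / (1 - γ) ≤ C) (hx : 0 ≤ x) :
    1 ≤ (1 + C * x) * mlE γ (-x) ∧ (1 + x) * mlE γ (-x) ≤ 1 := by
  change 1 ≤ (1 + C * x) * mlG γ 1 x ∧ (1 + x) * mlG γ 1 x ≤ 1
  rcases hx.eq_or_lt with h | hx0
  · rw [← h, mlG_zero]; simp
  have ht : 0 < x ^ γ⁻¹ := Real.rpow_pos_of_pos hx0 _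
  have L := phi_lower hγ h1 ht
  have U := phi_upper hγ h1 ht
  rw [Real.rpow_inv_rpow hx hγ.ne'] at L U
  have g1 : Real.Gamma (1 - γ) ≤ C := by
    refine le_trans ?_ hC
    rw [le_div_iff₀ (by linarith), mul_comm, ← Real.Gamma_add_one (by linarith)]
    exact gamma_le_one (by linarith) (by linarith)
  have g2 : Real.Gamma (γ + 1) ≤ 1 := gamma_le_one (by linarith) (by linarith)
  have g2p : 0 < Real.Gamma (γ + 1) := Real.Gamma_pos_of_pos (by linarith)
  have g1p : 0 < Real.Gamma (1 - γ) := Real.Gamma_pos_of_pos (by linarith)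
  have hp : 0 < mlG γ 1 x := by
    have : 0 < 1 + Real.Gamma (1 - γ) * x := by positivity
    exact pos_of_mul_pos_right (lt_of_lt_of_le one_pos L) this.le
  constructor
  · refine L.trans ?_
    gcongr
  · refine le_trans ?_ U
    gcongr
    exact le_div_self hx g2p g2

theorem stmt_2 (γ0 γ1 : ℝ) (h0 : 0 < γ0) (h01 : γ0 ≤ γ1) (h1 : γ1 < 1) :
    ∃ c C : ℝ, 0 < c ∧ 0 < C ∧
      ∀ γ ∈ Set.Icc γ0 γ1, ∀ T : ℝ, 0 < T → ∀ t : ℝ, 0 < t → t ≤ T →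
        ∀ (n : ℕ), 1 ≤ n → ∀ ξ : EuclideanSpace ℝ (Fin n),
          c ≤ mlE γ (-(‖ξ‖ ^ 2 * t ^ γ)) / mlE γ (-(‖ξ‖ ^ 2 * T ^ γ)) ∧
          mlE γ (-(‖ξ‖ ^ 2 * t ^ γ)) / mlE γ (-(‖ξ‖ ^ 2 * T ^ γ)) ≤ C * (T / t) ^ γ := by
  have hd : 0 < 1 - γ1 := by linarith
  set C : ℝ := 1 / (1 - γ1) with hCdef
  have hC0 : 0 < C := by positivity
  have hC1 : 1 ≤ C := by rw [hCdef, le_div_iff₀ hd]; linarith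
  refine ⟨1 / C, C, by positivity, hC0, ?_⟩
  intro γ hγ T hT t ht htT n _ ξ
  have hγ0 : 0 < γ := h0.trans_le hγ.1
  have hγ1 : γ < 1 := hγ.2.trans_lt h1
  have hCγ : 1 / (1 - γ) ≤ C := one_div_le_one_div_of_le hd (by linarith [hγ.2])
  have htp : 0 < t ^ γ := Real.rpow_pos_of_pos ht _
  have hTp : 0 < T ^ γ := Real.rpow_pos_of_pos hT _
  have hle : t ^ γ ≤ T ^ γ := Real.rpow_le_rpow ht.le htT hγ0.le
  set l : ℝ := ‖ξ‖ ^ 2 with hl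
  have hl0 : 0 ≤ l := by positivity
  have ha : 0 ≤ l * t ^ γ := by positivity
  have hb : 0 ≤ l * T ^ γ := by positivity
  have hab : l * t ^ γ ≤ l * T ^ γ := by gcongr
  obtain ⟨La, Ua⟩ := ml_bounds hγ0 hγ1 hCγ ha
  obtain ⟨Lb, Ub⟩ := ml_bounds hγ0 hγ1 hCγ hb
  rw [Real.div_rpow hT.le ht.le]
  set q := T ^ γ / t ^ γ with hq
  have hq1 : 1 ≤ q := by rw [hq, le_div_iff₀ htp]; linarith
  have hbq : l * T ^ γ = q * (l * t ^ γ) := by rw [hq]; field_simp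
  set a := l * t ^ γ
  set b := l * T ^ γ
  set A := mlE γ (-a)
  set B := mlE γ (-b)
  have hA : 0 < A := pos_of_mul_pos_right (lt_of_lt_of_le one_pos La) (by positivity)
  have hB : 0 < B := pos_of_mul_pos_right (lt_of_lt_of_le one_pos Lb) (by positivity)
  constructor
  · rw [le_div_iff₀ hB, one_div, inv_mul_le_iff₀ hC0]
    -- B ≤ 1/(1+b) and C * A ≥ 1/(1+a)
    have h3 : 1 ≤ (1 + b) * (C * A) := by
      refine La.trans ?_
      rw [← mul_assoc (1 + b)]
      refine mul_le_mul_of_nonneg_right ?_ hA.le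
      nlinarith [mul_le_mul_of_nonneg_left hab hC0.le]
    have h4 : (1 + b) * B ≤ (1 + b) * (C * A) := Ub.trans h3
    exact le_of_mul_le_mul_left h4 (by positivity)
  · rw [div_le_iff₀ hB]
    have h3 : (1 + C * b) ≤ (1 + a) * (C * q) := by
      rw [hbq]
      nlinarith [mul_nonneg hC0.le ha, one_le_mul_of_one_le_of_one_le hC1 hq1]
    have h4 : (1 + a) * A ≤ (1 + a) * (C * q * B) := by
      refine Ua.trans (Lb.trans ?_)
      rw [← mul_assoc (1 + a)]
      exact mul_le_mul_of_nonneg_right h3 hB.le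
    exact le_of_mul_le_mul_left h4 (by positivity)
end

section
/- Let γ ∈ (0,1), T > 0, τ > 0 and s > 0. There exists a constant C > 0 depending only on γ, T, τ, s and n such that for every α ∈ (0, 1] and every ξ ∈ ℝⁿ, exp(−τ (α|ξ|)^s) / E_γ(−|ξ|² T^γ) ≤ C / α². -/
open MeasureTheory Filter Topology Set in
lemma ml_beta (p q : ℝ) (hp : 0 < p) (hq : 0 < q) :
    IntegrableOn (fun x : ℝ => x ^ (p - 1) * (1 - x) ^ (q - 1)) (Ioo 0 1) ∧
    ∫ x in Ioo (0:ℝ) 1, x ^ (p - 1) * (1 - x) ^ (q - 1) =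
      Real.Gamma p * Real.Gamma q / Real.Gamma (p + q) := by
  have hc := Complex.betaIntegral_convergent (u := p) (v := q) (by simpa) (by simpa)
  rw [intervalIntegrable_iff_integrableOn_Ioo_of_le (by norm_num)] at hc
  have hcongr : ∀ x ∈ Ioo (0:ℝ) 1, (((x:ℂ) ^ ((p:ℂ) - 1) * (1 - (x:ℂ)) ^ ((q:ℂ) - 1))).re
      = x ^ (p - 1) * (1 - x) ^ (q - 1) := by
    intro x hx
    have h1 : (0:ℝ) ≤ x := hx.1.le
    have h2 : (0:ℝ) ≤ 1 - x := by linarith [hx.2]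
    norm_cast
    rw [← Complex.ofReal_cpow h1, ← Complex.ofReal_cpow h2, Complex.re_mul_ofReal,
      Complex.ofReal_re]
  constructor
  · have := hc.re
    refine IntegrableOn.congr_fun this (fun x hx => ?_) measurableSet_Ioo
    exact hcongr x hx
  · have hb := ProbabilityTheory.beta_eq_betaIntegralReal p q hp hq
    rw [ProbabilityTheory.beta] at hb
    rw [hb, Complex.betaIntegral, intervalIntegral.integral_of_le (by norm_num),
      integral_Ioc_eq_integral_Ioo, ← RCLike.re_to_complex, ← integral_re hc]
    exact (setIntegral_congr_fun measurableSet_Ioo hcongr).symm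

lemma ml_bern (a x : ℝ) (ha : 0 < a) (hx : x ∈ Set.Ioo (0:ℝ) 1) :
    0 ≤ 1 - x ^ a ∧ 1 - x ^ a ≤ (1 + a) * (1 - x) := by
  obtain ⟨h0, h1⟩ := hx
  refine ⟨by linarith [Real.rpow_le_one h0.le h1.le ha.le], ?_⟩
  rcases le_total a 1 with h | h
  · have := Real.rpow_le_rpow_of_exponent_ge h0 h1.le h
    rw [Real.rpow_one] at this
    nlinarith
  · have := one_add_mul_self_le_rpow_one_add (s := x - 1) (by linarith) h
    rw [show 1 + (x - 1) = x by ring] at this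
    nlinarith

open MeasureTheory Filter Topology Set in
lemma ml_int (γ a : ℝ) (h0 : 0 < γ) (h1 : γ < 1) (ha : 0 < a) :
    IntegrableOn (fun x : ℝ => γ * (1 - x) ^ (-γ - 1) * (1 - x ^ a)) (Ioo 0 1) ∧
    ∫ x in Ioo (0:ℝ) 1, γ * (1 - x) ^ (-γ - 1) * (1 - x ^ a) =
      Real.Gamma (1 - γ) * Real.Gamma (a + 1) / Real.Gamma (a + 1 - γ) - 1 := by
  obtain ⟨b1, b2⟩ := ml_beta a (1 - γ) ha (by linarith)
  obtain ⟨c1, -⟩ := ml_beta 1 (1 - γ) one_pos (by linarith)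
  have hI : IntegrableOn (fun x : ℝ => γ * (1 - x) ^ (-γ - 1) * (1 - x ^ a)) (Ioo 0 1) := by
    refine Integrable.mono' (c1.const_mul (γ * (1 + a))) ?_ ?_
    · exact Measurable.aestronglyMeasurable (by fun_prop)
    · refine ae_restrict_of_forall_mem measurableSet_Ioo (fun x hx => ?_)
      obtain ⟨e1, e2⟩ := ml_bern a x ha hx
      have hx2 : 0 < 1 - x := by linarith [hx.2]
      have hr : (1 - x) ^ (1 - γ - 1) = (1 - x) ^ (-γ - 1) * (1 - x) := by
        rw [← Real.rpow_add_one hx2.ne']; congr 1; ring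
      have hp : 0 < (1 - x) ^ (-γ - 1) := Real.rpow_pos_of_pos hx2 _
      rw [Real.norm_of_nonneg (by positivity), hr, sub_self, Real.rpow_zero]
      calc γ * (1 - x) ^ (-γ - 1) * (1 - x ^ a)
          ≤ γ * (1 - x) ^ (-γ - 1) * ((1 + a) * (1 - x)) := by gcongr
        _ = _ := by ring
  refine ⟨hI, ?_⟩
  have key := intervalIntegral.integral_eq_sub_of_hasDerivAt_of_tendsto (a := 0) (b := 1)
    (f := fun x : ℝ => (1 - x) ^ (-γ) * (1 - x ^ a))
    (f' := fun x : ℝ => γ * (1 - x) ^ (-γ - 1) * (1 - x ^ a)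
      - a * (x ^ (a - 1) * (1 - x) ^ (1 - γ - 1))) (fa := 1) (fb := 0) one_pos ?_ ?_ ?_ ?_
  · rw [intervalIntegral.integral_of_le (by norm_num), integral_Ioc_eq_integral_Ioo,
      integral_sub hI (b1.const_mul a), integral_const_mul, b2] at key
    rw [Real.Gamma_add_one ha.ne', show a + 1 - γ = a + (1 - γ) by ring]
    have : a * (Real.Gamma a * Real.Gamma (1 - γ) / Real.Gamma (a + (1 - γ)))
      = Real.Gamma (1 - γ) * (a * Real.Gamma a) / Real.Gamma (a + (1 - γ)) := by ring
    linarith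
  · intro x hx
    have hx2 : 0 < 1 - x := by linarith [hx.2]
    have d1 : HasDerivAt (fun x : ℝ => 1 - x) (-1) x := by
      simpa using (hasDerivAt_id x).const_sub 1
    have d2 := d1.rpow_const (p := -γ) (Or.inl hx2.ne')
    have d3 := (Real.hasDerivAt_rpow_const (x := x) (p := a) (Or.inl hx.1.ne')).const_sub 1
    have d4 := d2.mul d3
    refine d4.congr_deriv ?_
    rw [show 1 - γ - 1 = -γ by ring]
    ring
  · rw [intervalIntegrable_iff_integrableOn_Ioo_of_le (by norm_num)]
    exact hI.sub (b1.const_mul a)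
  · have : ContinuousAt (fun x : ℝ => (1 - x) ^ (-γ) * (1 - x ^ a)) 0 := by
      refine ContinuousAt.mul ?_ ?_
      · exact ContinuousAt.rpow_const (by fun_prop) (Or.inl (by norm_num))
      · exact continuousAt_const.sub (Real.continuousAt_rpow_const 0 a (Or.inr ha.le))
    have h2 := this.tendsto
    simp only [sub_zero, Real.one_rpow, Real.zero_rpow ha.ne', mul_one] at h2
    exact h2.mono_left nhdsWithin_le_nhds
  · have hu : Tendsto (fun x : ℝ => (1 + a) * (1 - x) ^ (1 - γ)) (𝓝[<] 1) (𝓝 0) := by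
      have : ContinuousAt (fun x : ℝ => (1 + a) * (1 - x) ^ (1 - γ)) 1 :=
        continuousAt_const.mul
          (ContinuousAt.rpow_const (by fun_prop) (Or.inr (by linarith)))
      have h2 := this.tendsto
      simp only [sub_self, Real.zero_rpow (by linarith : 1 - γ ≠ 0), mul_zero] at h2
      exact h2.mono_left nhdsWithin_le_nhds
    have hm : Ioo (0:ℝ) 1 ∈ 𝓝[<] (1:ℝ) := Ioo_mem_nhdsLT one_pos
    refine tendsto_of_tendsto_of_tendsto_of_le_of_le' tendsto_const_nhds hu ?_ ?_
    · filter_upwards [hm] with x hx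
      have hx2 : 0 < 1 - x := by linarith [hx.2]
      exact mul_nonneg (Real.rpow_nonneg hx2.le _) (ml_bern a x ha hx).1
    · filter_upwards [hm] with x hx
      have hx2 : 0 < 1 - x := by linarith [hx.2]
      have hr : (1 - x) ^ (1 - γ) = (1 - x) ^ (-γ) * (1 - x) := by
        rw [← Real.rpow_add_one hx2.ne']; congr 1; ring
      rw [hr]
      calc (1 - x) ^ (-γ) * (1 - x ^ a) ≤ (1 - x) ^ (-γ) * ((1 + a) * (1 - x)) := by
            gcongr; exact (ml_bern a x ha hx).2
        _ = _ := by ring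

lemma ml_gpos (γ : ℝ) (h0 : 0 < γ) (k : ℕ) : 0 < Real.Gamma (γ * k + 1) :=
  Real.Gamma_pos_of_pos (by positivity)

lemma ml_gratio (γ y : ℝ) (h0 : 0 < γ) (hy : 1 < y) :
    (y - 1) ^ γ * Real.Gamma y ≤ Real.Gamma (y + γ) := by
  have h := Real.convexOn_log_Gamma.slope_mono_adjacent (x := y - 1) (y := y) (z := y + γ)
    (by simpa using hy) (by simp only [Set.mem_Ioi]; linarith) (by linarith) (by linarith)
  have g1 : 0 < Real.Gamma (y - 1) := Real.Gamma_pos_of_pos (by linarith)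
  have g2 : 0 < Real.Gamma y := Real.Gamma_pos_of_pos (by linarith)
  have g3 : 0 < Real.Gamma (y + γ) := Real.Gamma_pos_of_pos (by linarith)
  have hy1 : 0 < y - 1 := by linarith
  have e : Real.Gamma y = (y - 1) * Real.Gamma (y - 1) := by
    have := Real.Gamma_add_one (s := y - 1) (by linarith)
    rwa [show y - 1 + 1 = y by ring] at this
  have e2 : Real.log (Real.Gamma y) = Real.log (y - 1) + Real.log (Real.Gamma (y - 1)) := by
    rw [e, Real.log_mul hy1.ne' g1.ne']
  simp only [Function.comp_apply, sub_sub_cancel, div_one, add_sub_cancel_left] at h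
  rw [le_div_iff₀ h0] at h
  rw [← Real.log_le_log_iff (by positivity) g3,
    Real.log_mul (Real.rpow_pos_of_pos hy1 _).ne' g2.ne', Real.log_rpow hy1]
  nlinarith

open Filter Topology in
lemma ml_summable (γ x : ℝ) (h0 : 0 < γ) (hx : 0 ≤ x) :
    Summable (fun k : ℕ => x ^ k / Real.Gamma (γ * k + 1)) := by
  refine summable_of_ratio_norm_eventually_le (r := 1 / 2) (by norm_num) ?_
  have ht : Tendsto (fun k : ℕ => (γ * (k:ℝ)) ^ γ) atTop atTop :=
    (tendsto_rpow_atTop h0).comp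
      (Tendsto.const_mul_atTop h0 tendsto_natCast_atTop_atTop)
  filter_upwards [ht.eventually_ge_atTop (2 * x), eventually_gt_atTop 0] with k hk hk0
  have g1 := ml_gpos γ h0 k
  have g2 := ml_gpos γ h0 (k + 1)
  have hk1 : (0:ℝ) < k := by exact_mod_cast hk0
  have h := ml_gratio γ (γ * k + 1) h0 (by nlinarith [mul_pos h0 hk1])
  rw [add_sub_cancel_right, show γ * k + 1 + γ = γ * ((k + 1 : ℕ) : ℝ) + 1 by push_cast; ring] at h
  rw [Real.norm_of_nonneg (by positivity), Real.norm_of_nonneg (by positivity),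
    div_le_iff₀ g2, pow_succ]
  have h3 : 2 * x * Real.Gamma (γ * k + 1) ≤ Real.Gamma (γ * ((k + 1 : ℕ) : ℝ) + 1) :=
    le_trans (by gcongr) h
  calc x ^ k * x = 1 / 2 * (x ^ k / Real.Gamma (γ * k + 1)) * (2 * x * Real.Gamma (γ * k + 1)) := by
        field_simp
    _ ≤ _ := by gcongr

lemma ml_summable_abs (γ x : ℝ) (h0 : 0 < γ) :
    Summable (fun k : ℕ => x ^ k / Real.Gamma (γ * k + 1)) := by
  refine Summable.of_norm ?_
  refine (ml_summable γ |x| h0 (abs_nonneg x)).congr (fun k => ?_)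
  rw [norm_div, norm_pow, Real.norm_eq_abs, Real.norm_of_nonneg (ml_gpos γ h0 k).le]

open MeasureTheory Set in
/-- At a point where `E_γ(-·)` is minimal on `[0,x]` the sharp lower bound holds. -/
lemma ml_min (γ x : ℝ) (h0 : 0 < γ) (h1 : γ < 1) (hx : 0 ≤ x)
    (hmin : ∀ y ∈ Icc 0 x, mlE γ (-x) ≤ mlE γ (-y)) :
    1 ≤ mlE γ (-x) * (1 + Real.Gamma (1 - γ) * x) := by
  set G := Real.Gamma (1 - γ) with hG
  have hGpos : 0 < G := Real.Gamma_pos_of_pos (by linarith)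
  let w : ℝ → ℝ := fun t => γ * (1 - t) ^ (-γ - 1)
  let c : ℕ → ℝ := fun k => (-x) ^ k / Real.Gamma (γ * k + 1)
  let F : ℕ → ℝ → ℝ := fun k t => c k * (w t * (1 - t ^ (γ * k)))
  have hcs : Summable c := ml_summable_abs γ (-x) h0
  have hcabs : ∀ k, |c k| = x ^ k / Real.Gamma (γ * k + 1) := by
    intro k
    simp only [c]
    rw [abs_div, abs_pow, abs_neg, abs_of_nonneg hx, abs_of_pos (ml_gpos γ h0 k)]
  have hF0 : F 0 = fun _ => 0 := by funext t; simp [F]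
  have hak : ∀ k : ℕ, 0 < γ * ((k + 1 : ℕ) : ℝ) := fun k => by positivity
  have hJ : ∀ k : ℕ, ∫ t in Ioo (0:ℝ) 1, w t * (1 - t ^ (γ * ((k + 1 : ℕ) : ℝ))) =
      G * Real.Gamma (γ * ((k + 1 : ℕ) : ℝ) + 1) / Real.Gamma (γ * k + 1) - 1 := by
    intro k
    have := (ml_int γ _ h0 h1 (hak k)).2
    rw [show γ * ((k + 1 : ℕ) : ℝ) + 1 - γ = γ * k + 1 by push_cast; ring] at this
    exact this
  have hFint : ∀ k, Integrable (F k) (volume.restrict (Ioo 0 1)) := by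
    intro k
    rcases k with _ | k
    · rw [hF0]; exact integrable_zero _ _ _
    · exact (ml_int γ _ h0 h1 (hak k)).1.const_mul _
  have hnorm : ∀ k : ℕ, ∫ t in Ioo (0:ℝ) 1, ‖F (k + 1) t‖ =
      |c (k + 1)| * (G * Real.Gamma (γ * ((k + 1 : ℕ) : ℝ) + 1) / Real.Gamma (γ * k + 1) - 1) := by
    intro k
    rw [← hJ, ← integral_const_mul]
    refine setIntegral_congr_fun measurableSet_Ioo (fun t ht => ?_)
    have e1 := (ml_bern _ t (hak k) ht).1
    have e2 : 0 ≤ w t := mul_nonneg h0.le (Real.rpow_nonneg (by linarith [ht.2]) _)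
    simp only [F]
    rw [norm_mul, Real.norm_eq_abs, Real.norm_of_nonneg (mul_nonneg e2 e1)]
  have hFsum : Summable fun k => ∫ t in Ioo (0:ℝ) 1, ‖F k t‖ := by
    rw [← summable_nat_add_iff 1]
    simp_rw [hnorm, hcabs]
    have s1 := (ml_summable γ x h0 hx).mul_left (x * G)
    have s2 := (summable_nat_add_iff 1).2 (ml_summable γ x h0 hx)
    refine (s1.sub s2).congr (fun k => ?_)
    have g1 := (ml_gpos γ h0 k).ne'
    have g2 := (ml_gpos γ h0 (k + 1)).ne'
    rw [pow_succ]
    field_simp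
  have hs := hasSum_integral_of_summable_integral_norm hFint hFsum
  have hle : ∫ t in Ioo (0:ℝ) 1, (∑' k, F k t) ≤ 0 := by
    refine setIntegral_nonpos measurableSet_Ioo (fun t ht => ?_)
    have e2 : 0 ≤ w t := mul_nonneg h0.le (Real.rpow_nonneg (by linarith [ht.2]) _)
    have tp : 0 ≤ t ^ γ := Real.rpow_nonneg ht.1.le _
    have tl : t ^ γ ≤ 1 := Real.rpow_le_one ht.1.le ht.2.le h0.le
    have hk : ∀ k, F k t = w t * (c k - (-(x * t ^ γ)) ^ k / Real.Gamma (γ * k + 1)) := by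
      intro k
      have : (-(x * t ^ γ)) ^ k = (-x) ^ k * t ^ (γ * k) := by
        rw [← neg_mul, mul_pow, Real.rpow_mul ht.1.le, Real.rpow_natCast]
      simp only [F]
      rw [this]
      simp only [c]
      ring
    simp_rw [hk]
    rw [tsum_mul_left, hcs.tsum_sub (ml_summable_abs γ _ h0)]
    have := hmin (x * t ^ γ) ⟨by positivity, by nlinarith⟩
    simp only [mlE] at this
    exact mul_nonpos_of_nonneg_of_nonpos e2 (by simp only [c]; linarith)
  have hint : ∀ k : ℕ, ∫ t in Ioo (0:ℝ) 1, F (k + 1) t = (-x * G) * c k - c (k + 1) := by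
    intro k
    simp only [F]
    rw [integral_const_mul, hJ]
    have g1 := (ml_gpos γ h0 k).ne'
    have g2 := (ml_gpos γ h0 (k + 1)).ne'
    simp only [c]
    rw [pow_succ]
    field_simp
    ring
  have hv := hs.tsum_eq
  rw [hs.summable.tsum_eq_zero_add, hF0] at hv
  simp only [hint, integral_zero, zero_add] at hv
  have hcs1 : Summable fun k => c (k + 1) := (summable_nat_add_iff 1).2 hcs
  rw [(hcs.mul_left _).tsum_sub hcs1, tsum_mul_left] at hv
  have hE := hcs.tsum_eq_zero_add
  have hc0 : c 0 = 1 := by simp [c]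
  have hdef : mlE γ (-x) = ∑' k, c k := rfl
  rw [hc0] at hE
  rw [hdef]
  nlinarith

open Set in
lemma ml_lower (γ x : ℝ) (h0 : 0 < γ) (h1 : γ < 1) (hx : 0 ≤ x) :
    1 / (1 + Real.Gamma (1 - γ) * x) ≤ mlE γ (-x) := by
  have hGpos : 0 < Real.Gamma (1 - γ) := Real.Gamma_pos_of_pos (by linarith)
  have hcont : ContinuousOn (fun y => mlE γ (-y)) (Icc 0 x) := by
    unfold mlE
    refine continuousOn_tsum (u := fun k : ℕ => x ^ k / Real.Gamma (γ * k + 1)) ?_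
      (ml_summable γ x h0 hx) ?_
    · intro k; fun_prop
    · intro k y hy
      rw [norm_div, norm_pow, norm_neg, Real.norm_of_nonneg hy.1,
        Real.norm_of_nonneg (ml_gpos γ h0 k).le]
      have := ml_gpos γ h0 k
      have := hy.1
      gcongr
      exact hy.2
  obtain ⟨z, hz, hzmin⟩ := isCompact_Icc.exists_isMinOn ⟨0, left_mem_Icc.2 hx⟩ hcont
  have hm := ml_min γ z h0 h1 hz.1 (fun y hy => hzmin ⟨hy.1, hy.2.trans hz.2⟩)
  have hzx : mlE γ (-z) ≤ mlE γ (-x) := hzmin (right_mem_Icc.2 hx)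
  refine le_trans ?_ hzx
  have hz0 := hz.1
  calc 1 / (1 + Real.Gamma (1 - γ) * x) ≤ 1 / (1 + Real.Gamma (1 - γ) * z) := by
        gcongr; exact hz.2
    _ ≤ _ := by rw [div_le_iff₀ (by positivity)]; exact hm

lemma ml_exp_bound (τ s y : ℝ) (hτ : 0 < τ) (hs : 0 < s) (hy : 0 ≤ y) :
    y ^ 2 * Real.exp (-(τ * y ^ s)) ≤ ((2 / s) / τ) ^ (2 / s) := by
  set p := 2 / s with hp
  have hp0 : 0 < p := by positivity
  have hz : 0 ≤ y ^ s := Real.rpow_nonneg hy s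
  have e1 : y ^ 2 = (y ^ s) ^ p := by
    rw [← Real.rpow_mul hy, hp, mul_div_cancel₀ _ hs.ne']; norm_num
  have h := Real.add_one_le_exp (τ * y ^ s / p)
  have h2 : (τ * y ^ s / p) ^ p ≤ Real.exp (τ * y ^ s) := by
    calc (τ * y ^ s / p) ^ p ≤ (Real.exp (τ * y ^ s / p)) ^ p := by
          gcongr; linarith
      _ = _ := by rw [← Real.exp_mul, div_mul_cancel₀ _ hp0.ne']
  rw [Real.exp_neg, ← div_eq_mul_inv, div_le_iff₀ (Real.exp_pos _), e1]
  calc (y ^ s) ^ p = (p / τ) ^ p * (τ * y ^ s / p) ^ p := by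
        rw [← Real.mul_rpow (by positivity) (by positivity)]
        congr 1; field_simp
    _ ≤ _ := by gcongr

theorem stmt_5 (n : ℕ) (hn : 1 ≤ n) (γ T τ s : ℝ) (hγ0 : 0 < γ) (hγ1 : γ < 1)
    (hT : 0 < T) (hτ : 0 < τ) (hs : 0 < s) :
    ∃ C : ℝ, 0 < C ∧ ∀ α ∈ Set.Ioc (0 : ℝ) 1, ∀ ξ : EuclideanSpace ℝ (Fin n),
      Real.exp (-(τ * (α * ‖ξ‖) ^ s)) / mlE γ (-(‖ξ‖ ^ 2 * T ^ γ)) ≤ C / α ^ 2 := by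
  have hG : 0 < Real.Gamma (1 - γ) := Real.Gamma_pos_of_pos (by linarith)
  have hTg : 0 < T ^ γ := Real.rpow_pos_of_pos hT γ
  set B := ((2 / s) / τ) ^ (2 / s) with hB
  have hB0 : 0 < B := by positivity
  refine ⟨1 + Real.Gamma (1 - γ) * T ^ γ * B, by positivity, ?_⟩
  intro α hα ξ
  obtain ⟨ha0, ha1⟩ := hα
  set r := ‖ξ‖ with hr
  have hr0 : 0 ≤ r := norm_nonneg ξ
  have hl := ml_lower γ (r ^ 2 * T ^ γ) hγ0 hγ1 (by positivity)
  have hb := ml_exp_bound τ s (α * r) hτ hs (by positivity)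
  rw [← hB] at hb
  set e := Real.exp (-(τ * (α * r) ^ s)) with he
  have he0 : 0 < e := Real.exp_pos _
  have he1 : e ≤ 1 := Real.exp_le_one_iff.2 (by
    have : 0 ≤ (α * r) ^ s := Real.rpow_nonneg (by positivity) _
    nlinarith)
  have ha2 : α ^ 2 ≤ 1 := pow_le_one₀ ha0.le ha1
  calc e / mlE γ (-(r ^ 2 * T ^ γ))
      ≤ e / (1 / (1 + Real.Gamma (1 - γ) * (r ^ 2 * T ^ γ))) := by gcongr
    _ = e * (1 + Real.Gamma (1 - γ) * (r ^ 2 * T ^ γ)) := by rw [div_div_eq_mul_div, div_one]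
    _ ≤ _ := by
      rw [le_div_iff₀ (by positivity)]
      calc e * (1 + Real.Gamma (1 - γ) * (r ^ 2 * T ^ γ)) * α ^ 2
          = e * α ^ 2 + Real.Gamma (1 - γ) * T ^ γ * ((α * r) ^ 2 * e) := by ring
        _ ≤ 1 + Real.Gamma (1 - γ) * T ^ γ * B := by
          gcongr
          exact mul_le_one₀ he1 (by positivity) ha2
end
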